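/- (Existence of commuting sl₂ × sl₂ actions from bigraded hard Lefschetz.) Under the stated bigraded hard Lefschetz hypotheses, there exist linear endomorphisms f₁, h₁, f₂, h₂ of V such that: h₁(v) = i·v and h₂(v) = (j − i)·v for all v ∈ V_i^j; the triples satisfy the sl₂ commutation relations [h₁,η] = 2η, [h₁,f₁] = −2f₁, [η,f₁] = h₁ and [h₂,β] = 2β, [h₂,f₂] = −2f₂, [β,f₂] = h₂; and each of η, f₁, h₁ commutes with each of β, f₂, h₂ (so that V carries a representation of sl₂(ℝ) × sl₂(ℝ) with η and β as the two raising operators). -/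

import Mathlib

namespace DirectSum.IsInternal

variable {K V ι : Type*} [Field K] [AddCommGroup V] [Module K V] [DecidableEq ι]
  {W : ι → Submodule K V}

/-- Linear maps that agree on every summand of an internal direct sum are equal. -/
lemma linearMap_ext (hW : DirectSum.IsInternal W) {f g : Module.End K V}
    (h : ∀ p, ∀ v ∈ W p, f v = g v) : f = g := by
  ext v
  have hv : v ∈ ⨆ p, W p := by rw [hW.submodule_iSup_eq_top]; trivial
  induction hv using Submodule.iSup_induction' with
  | mem p v hv => exact h p v hv
  | zero => simp
  | add x y _ _ hx hy => simp [hx, hy]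

/-- An endomorphism may be prescribed on each summand of an internal direct sum. -/
lemma exists_linearMap (hW : DirectSum.IsInternal W) (φ : ι → Module.End K V) :
    ∃ f : Module.End K V, ∀ p, ∀ v ∈ W p, f v = φ p v := by
  let E := LinearEquiv.ofBijective (DirectSum.coeLinearMap W) hW
  refine ⟨DirectSum.toModule K ι V (fun p ↦ φ p ∘ₗ (W p).subtype) ∘ₗ E.symm.toLinearMap, ?_⟩
  intro p v hv
  have : E.symm v = DirectSum.lof K ι (fun p ↦ W p) p ⟨v, hv⟩ := by
    rw [LinearEquiv.symm_apply_eq]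
    exact (DirectSum.coeLinearMap_lof W p ⟨v, hv⟩).symm
  simp [this]

/-- Every internal direct sum has a family of projections onto its summands. -/
lemma exists_projections (hW : DirectSum.IsInternal W) :
    ∃ π : ι → Module.End K V, (∀ p, ∀ v ∈ W p, π p v = v) ∧
      (∀ p q, p ≠ q → ∀ v ∈ W q, π p v = 0) ∧ ∀ p v, π p v ∈ W p := by
  choose π hπ using fun p ↦ hW.exists_linearMap (fun q ↦ if q = p then 1 else 0)
  refine ⟨π, fun p v hv ↦ by simp [hπ p p v hv], fun p q hpq v hv ↦ by
    simp [hπ p q v hv, hpq.symm], fun p v ↦ ?_⟩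
  have hv : v ∈ ⨆ p, W p := by rw [hW.submodule_iSup_eq_top]; trivial
  induction hv using Submodule.iSup_induction' with
  | mem q v hv =>
    rw [hπ p q v hv]
    split_ifs with h
    · exact h ▸ hv
    · simp
  | zero => simp
  | add x y _ _ hx hy => simpa using add_mem hx hy

end DirectSum.IsInternal

section Trace

variable {K V : Type*} [Field K] [AddCommGroup V] [Module K V] [FiniteDimensional K V]

/-- The trace form on `End V` is nondegenerate. -/
lemma LinearMap.eq_zero_of_forall_trace_mul_eq_zero {z : Module.End K V}
    (hz : ∀ a, LinearMap.trace K V (z * a) = 0) : z = 0 := by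
  ext v
  rw [LinearMap.zero_apply, ← Module.forall_dual_apply_eq_zero_iff K]
  intro ψ
  have h := hz (ψ.smulRight v)
  have hmul : z * ψ.smulRight v = ψ.smulRight (z v) := by ext; simp
  rwa [hmul, LinearMap.trace_smulRight] at h

/-- Every linear functional on `End V` is of the form `a ↦ tr (z a)`. -/
lemma LinearMap.exists_trace_mul_eq (φ : Module.Dual K (Module.End K V)) :
    ∃ z : Module.End K V, ∀ a, φ a = LinearMap.trace K V (z * a) := by
  let T : Module.End K V →ₗ[K] Module.Dual K (Module.End K V) :=
    (LinearMap.mul K (Module.End K V)).compr₂ (LinearMap.trace K V)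
  have hT : Function.Injective T := by
    rw [injective_iff_map_eq_zero]
    exact fun z hz ↦ LinearMap.eq_zero_of_forall_trace_mul_eq_zero (LinearMap.congr_fun hz)
  obtain ⟨z, hz⟩ := (LinearMap.injective_iff_surjective_of_finrank_eq_finrank
    (Subspace.dual_finrank_eq (K := K) (V := Module.End K V)).symm).mp hT φ
  exact ⟨z, fun a ↦ by rw [← hz]; rfl⟩

/-- An endomorphism is a commutator with `e` as soon as it is orthogonal, for the trace form, to
the centralizer of `e`. -/
lemma LinearMap.exists_commutator_eq_of_trace (e h : Module.End K V)
    (H : ∀ z, Commute z e → LinearMap.trace K V (z * h) = 0) :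
    ∃ f, e * f - f * e = h := by
  let A : Module.End K (Module.End K V) :=
    LinearMap.mulLeft K e - LinearMap.mulRight K e
  by_contra hn
  have hmem : h ∉ LinearMap.range A := fun ⟨f, hf⟩ ↦ hn ⟨f, by simpa [A] using hf⟩
  obtain ⟨φ, hφ, hle⟩ := Submodule.exists_le_ker_of_notMem hmem
  obtain ⟨z, hz⟩ := LinearMap.exists_trace_mul_eq φ
  refine hφ ((hz h).trans (H z ?_))
  obtain ⟨y, hy⟩ : ∃ y, y = z * e - e * z := ⟨_, rfl⟩
  have key : ∀ a, LinearMap.trace K V (y * a) = 0 := by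
    intro a
    have h1 : φ (e * a - a * e) = 0 := hle ⟨a, by simp [A]⟩
    rw [hz, mul_sub, map_sub, ← mul_assoc, ← mul_assoc, LinearMap.trace_mul_comm K (z * a) e] at h1
    rw [hy, sub_mul, map_sub, mul_assoc e z a]
    exact h1
  exact sub_eq_zero.mp (hy ▸ LinearMap.eq_zero_of_forall_trace_mul_eq_zero key)

end Trace

section Lefschetz

variable {K V ι : Type*} [Field K] [AddCommGroup V] [Module K V]
  [AddCommGroup ι] {W : ι → Submodule K V} {w : ι →+ ℤ} {d : ι}
  {e h : Module.End K V}

lemma pow_apply_mem_of_degree (he : ∀ p, ∀ v ∈ W p, e v ∈ W (p + d)) (n : ℕ) (p : ι) (v : V)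
    (hv : v ∈ W p) : (e ^ n) v ∈ W (p + n • d) := by
  induction n with
  | zero => simpa using hv
  | succ n ih =>
    rw [pow_succ', Module.End.mul_apply, succ_nsmul, ← add_assoc]
    exact he _ _ ih

variable [DecidableEq ι]

/-- If a homogeneous operator `E` maps one summand isomorphically onto another, then any operator
commuting with `E` has the same trace on the two summands. -/
lemma trace_mul_projection_eq_of_commute
    {π : ι → Module.End K V} (hW : DirectSum.IsInternal W)
    (hπ : ∀ p, ∀ v ∈ W p, π p v = v) (hπ' : ∀ p q, p ≠ q → ∀ v ∈ W q, π p v = 0)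
    (hπm : ∀ p v, π p v ∈ W p) {p q : ι} {E : Module.End K V}
    (hE : ∀ r, ∀ v ∈ W r, E v ∈ W (r + (q - p)))
    (hmap : (W p).map E = W q) (hinj : ∀ v ∈ W p, E v = 0 → v = 0)
    {z : Module.End K V} (hz : Commute z E) :
    LinearMap.trace K V (z * π p) = LinearMap.trace K V (z * π q) := by
  have hEp : ∀ v ∈ W p, E v ∈ W q := fun v hv ↦ hmap ▸ Submodule.mem_map_of_mem hv
  let E' : W p →ₗ[K] W q := E.restrict hEp
  have hb : Function.Bijective E' := by
    constructor
    · rw [injective_iff_map_eq_zero]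
      intro v hv
      exact Subtype.ext (hinj v v.2 (congrArg Subtype.val hv))
    · rintro ⟨v, hv⟩
      rw [← hmap] at hv
      obtain ⟨u, hu, rfl⟩ := hv
      exact ⟨⟨u, hu⟩, rfl⟩
  let F := LinearEquiv.ofBijective E' hb
  let g : Module.End K V :=
    (W p).subtype ∘ₗ F.symm.toLinearMap ∘ₗ (π q).codRestrict (W q) (hπm q)
  have hEg : E * g = π q := by
    ext v
    exact congrArg Subtype.val (F.apply_symm_apply ⟨π q v, hπm q v⟩)
  have hgE : g * E = π p := by
    refine hW.linearMap_ext fun r v hv ↦ ?_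
    by_cases hr : p = r
    · subst hr
      rw [hπ p v hv]
      have : (π q).codRestrict (W q) (hπm q) (E v) = F ⟨v, hv⟩ :=
        Subtype.ext (hπ q _ (hEp v hv))
      change ((F.symm ((π q).codRestrict (W q) (hπm q) (E v)) : W p) : V) = v
      rw [this, F.symm_apply_apply]
    · rw [hπ' p r hr v hv]
      have : (π q).codRestrict (W q) (hπm q) (E v) = 0 :=
        Subtype.ext (hπ' q _ (fun h ↦ hr (by
          have h2 : r - p = 0 := by rw [← sub_eq_zero.mpr h.symm]; abel
          exact (sub_eq_zero.mp h2).symm)) _ (hE r v hv))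
      change ((F.symm ((π q).codRestrict (W q) (hπm q) (E v)) : W p) : V) = 0
      rw [this, map_zero]; rfl
  rw [← hgE, ← hEg, ← mul_assoc, LinearMap.trace_mul_comm, ← mul_assoc, ← mul_assoc, hz.eq]

/-- Under hard Lefschetz, the weight operator is orthogonal to the centralizer of the Lefschetz
operator for the trace form. -/
lemma trace_mul_weight_eq_zero_of_lefschetz [FiniteDimensional K V] [CharZero K]
    (hW : DirectSum.IsInternal W)
    (hd : w d = 2) (he : ∀ p, ∀ v ∈ W p, e v ∈ W (p + d))
    (hL : ∀ (p : ι) (n : ℕ), w p = -n →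
      (W p).map (e ^ n) = W (p + n • d) ∧ ∀ v ∈ W p, (e ^ n) v = 0 → v = 0)
    (hh : ∀ p, ∀ v ∈ W p, h v = (w p : K) • v)
    (z : Module.End K V) (hz : Commute z e) : LinearMap.trace K V (z * h) = 0 := by
  obtain ⟨π, hπ, hπ', hπm⟩ := hW.exists_projections
  let σ : ι → ι := fun p ↦ p - w p • d
  have hwσ : ∀ p, w (σ p) = -w p := fun p ↦ by
    simp only [σ, map_sub, map_zsmul, hd, smul_eq_mul]; ring
  have hσσ : ∀ p, σ (σ p) = p := fun p ↦ by
    change σ p - w (σ p) • d = p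
    rw [hwσ]
    simp [σ]
  have hneg : ∀ (p : ι), w p ≤ 0 →
      LinearMap.trace K V (z * π p) = LinearMap.trace K V (z * π (σ p)) := by
    intro p hp
    obtain ⟨n, hn⟩ : ∃ n : ℕ, w p = -n := ⟨(-w p).toNat, by omega⟩
    have hσp : σ p = p + n • d := by simp [σ, hn]
    obtain ⟨h1, h2⟩ := hL p n hn
    rw [hσp]
    refine trace_mul_projection_eq_of_commute hW hπ hπ' hπm (fun r v hv ↦ ?_) h1 h2
      (hz.pow_right n)
    rw [add_sub_cancel_left]
    exact pow_apply_mem_of_degree he n r v hv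
  have htr : ∀ p, LinearMap.trace K V (z * π (σ p)) = LinearMap.trace K V (z * π p) := by
    intro p
    rcases le_total (w p) 0 with hp | hp
    · exact (hneg p hp).symm
    · rw [hneg (σ p) (by rw [hwσ]; omega), hσσ]
  have hfin : {p | W p ≠ ⊥}.Finite :=
    WellFoundedGT.finite_ne_bot_of_iSupIndep hW.submodule_iSupIndep
  let s := hfin.toFinset ∪ hfin.toFinset.image σ
  have hσs : ∀ p ∈ s, σ p ∈ s := by
    intro p hp
    rcases Finset.mem_union.mp hp with hp | hp
    · exact Finset.mem_union_right _ (Finset.mem_image_of_mem σ hp)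
    · obtain ⟨q, hq, rfl⟩ := Finset.mem_image.mp hp
      rw [hσσ]
      exact Finset.mem_union_left _ hq
  have hsum : h = ∑ p ∈ s, (w p : K) • π p := by
    refine hW.linearMap_ext fun p v hv ↦ ?_
    rw [hh p v hv, LinearMap.sum_apply]
    by_cases hp : p ∈ s
    · rw [Finset.sum_eq_single_of_mem p hp]
      · rw [LinearMap.smul_apply, hπ p v hv]
      · intro q _ hqp
        rw [LinearMap.smul_apply, hπ' q p hqp v hv, smul_zero]
    · have : W p = ⊥ := by
        by_contra hb
        exact hp (Finset.mem_union_left _ (hfin.mem_toFinset.mpr hb))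
      rw [this, Submodule.mem_bot] at hv
      simp [hv]
  have htrh : LinearMap.trace K V (z * h) =
      ∑ p ∈ s, (w p : K) * LinearMap.trace K V (z * π p) := by
    rw [hsum, Finset.mul_sum, map_sum]
    exact Finset.sum_congr rfl fun p _ ↦ by rw [mul_smul_comm, map_smul, smul_eq_mul]
  have hanti : LinearMap.trace K V (z * h) = -LinearMap.trace K V (z * h) := by
    rw [htrh, ← Finset.sum_neg_distrib]
    refine Finset.sum_bij' (fun p _ ↦ σ p) (fun p _ ↦ σ p) hσs hσs (fun p _ ↦ hσσ p)
      (fun p _ ↦ hσσ p) fun p _ ↦ ?_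
    rw [hwσ, htr]
    simp
  exact self_eq_neg.mp hanti

/-- **Hard Lefschetz gives an `sl₂` action.** A graded operator satisfying hard Lefschetz is the
raising operator of an `sl₂`-triple whose semisimple element is the weight operator. -/
lemma exists_sl2_lowering_of_lefschetz [FiniteDimensional K V] [CharZero K]
    (hW : DirectSum.IsInternal W)
    (hd : w d = 2) (he : ∀ p, ∀ v ∈ W p, e v ∈ W (p + d))
    (hL : ∀ (p : ι) (n : ℕ), w p = -n →
      (W p).map (e ^ n) = W (p + n • d) ∧ ∀ v ∈ W p, (e ^ n) v = 0 → v = 0)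
    (hh : ∀ p, ∀ v ∈ W p, h v = (w p : K) • v) :
    ∃ f : Module.End K V,
      h * e - e * h = 2 • e ∧ h * f - f * h = -(2 • f) ∧ e * f - f * e = h := by
  obtain ⟨f₀, hf₀⟩ := LinearMap.exists_commutator_eq_of_trace e h
    (trace_mul_weight_eq_zero_of_lefschetz hW hd he hL hh)
  obtain ⟨π, hπ, hπ', hπm⟩ := hW.exists_projections
  obtain ⟨f, hf⟩ := hW.exists_linearMap fun p ↦ π (p - d) * f₀
  have hfm : ∀ p, ∀ v ∈ W p, f v ∈ W (p - d) := fun p v hv ↦ by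
    rw [hf p v hv]
    exact hπm _ _
  have hcomm : ∀ p v, e (π (p - d) v) = π p (e v) := by
    intro p
    refine LinearMap.congr_fun (f := e * π (p - d)) (g := π p * e)
      (hW.linearMap_ext fun q v hv ↦ ?_)
    rw [Module.End.mul_apply, Module.End.mul_apply]
    by_cases hq : p - d = q
    · subst hq
      have := he _ v hv
      rw [sub_add_cancel] at this
      rw [hπ _ v hv, hπ _ _ this]
    · rw [hπ' _ q hq v hv, hπ' _ (q + d) (fun h ↦ hq (sub_eq_iff_eq_add.mpr h)) _ (he q v hv),
        map_zero]
  refine ⟨f, hW.linearMap_ext fun p v hv ↦ ?_, hW.linearMap_ext fun p v hv ↦ ?_,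
    hW.linearMap_ext fun p v hv ↦ ?_⟩
  · simp only [LinearMap.sub_apply, Module.End.mul_apply, LinearMap.smul_apply]
    rw [hh _ _ (he p v hv), hh p v hv, map_smul, map_add, hd, ← sub_smul]
    push_cast
    rw [add_sub_cancel_left, ofNat_smul_eq_nsmul K]
  · simp only [LinearMap.sub_apply, Module.End.mul_apply, LinearMap.smul_apply,
      LinearMap.neg_apply]
    rw [hh _ _ (hfm p v hv), hh p v hv, map_smul, map_sub, hd, ← sub_smul]
    push_cast
    rw [sub_sub_cancel_left, neg_smul, ofNat_smul_eq_nsmul K]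
  · simp only [LinearMap.sub_apply, Module.End.mul_apply]
    rw [hf p v hv, hf (p + d) (e v) (he p v hv), Module.End.mul_apply, Module.End.mul_apply,
      hcomm, add_sub_cancel_right, ← map_sub]
    have h1 : e (f₀ v) - f₀ (e v) = h v := LinearMap.congr_fun hf₀ v
    rw [h1, hh p v hv, map_smul, hπ p v hv]

/-- In a finite-dimensional representation, an operator commuting with the raising and semisimple
operators of an `sl₂`-triple commutes with the lowering operator. -/
lemma commute_sl2_lowering [FiniteDimensional K V] [CharZero K] {f x : Module.End K V}
    (hhe : h * e - e * h = 2 • e) (hhf : h * f - f * h = -(2 • f)) (hef : e * f - f * e = h)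
    (hxe : Commute x e) (hxh : Commute x h) : Commute x f := by
  by_cases h0 : h = 0
  · have : f = 0 := by
      rw [h0] at hhf
      have h2 : (2 : K) • f = 0 := by
        rw [ofNat_smul_eq_nsmul K]
        simpa using hhf.symm
      exact (smul_eq_zero.mp h2).resolve_left two_ne_zero
    rw [this]
    exact Commute.zero_right x
  let _ : LieRing (Module.End K V) := LieRing.ofAssociativeRing
  have t : IsSl2Triple h e f := ⟨h0, hef, hhe, hhf⟩
  by_contra hn
  have P : t.HasPrimitiveVectorWith (x * f - f * x) (-2 : K) := by
    refine ⟨fun h1 ↦ hn (sub_eq_zero.mp h1), ?_, ?_⟩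
    · have h1 : ⁅h, x * f - f * x⁆ = x * (h * f - f * h) - (h * f - f * h) * x := by
        rw [Ring.lie_def]
        simp only [mul_sub, sub_mul, ← mul_assoc, hxh.eq]
        simp only [mul_assoc, hxh.eq]
        abel
      rw [h1, hhf, neg_smul, ofNat_smul_eq_nsmul K]
      simp only [mul_neg, neg_mul, mul_smul_comm, smul_mul_assoc, smul_sub, neg_sub]
      rw [sub_neg_eq_add, neg_add_eq_sub]
    · have h1 : ⁅e, x * f - f * x⁆ = x * (e * f - f * e) - (e * f - f * e) * x := by
        rw [Ring.lie_def]
        simp only [mul_sub, sub_mul, ← mul_assoc, hxe.eq]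
        simp only [mul_assoc, hxe.eq]
        abel
      rw [h1, hef, hxh.eq, sub_self]
  obtain ⟨n, hn⟩ := P.exists_nat
  have h2 : ((n + 2 : ℕ) : K) = 0 := by
    push_cast
    rw [← hn]
    ring
  exact absurd (Nat.cast_eq_zero.mp h2) (by omega)

end Lefschetz


/-- **Existence of commuting sl₂ × sl₂ actions from bigraded hard Lefschetz.**

Under the bigraded hard Lefschetz hypotheses for commuting operators `η`
(bidegree `(2,2)`) and `β` (bidegree `(0,2)`) on a finite-dimensional bigraded
real vector space `V = ⊕ V_i^j`, there exist endomorphisms `f₁, h₁, f₂, h₂`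
with `h₁ = i` and `h₂ = j - i` on `V_i^j`, satisfying the sl₂ commutation
relations `[h₁,η] = 2η`, `[h₁,f₁] = -2f₁`, `[η,f₁] = h₁` and
`[h₂,β] = 2β`, `[h₂,f₂] = -2f₂`, `[β,f₂] = h₂`, and such that each of
`η, f₁, h₁` commutes with each of `β, f₂, h₂`. -/
theorem sl2_sl2_action_of_bigraded_hard_lefschetz
    (V : Type*) [AddCommGroup V] [Module ℝ V] [FiniteDimensional ℝ V]
    (Vg : ℤ × ℤ → Submodule ℝ V)
    (hgrading : DirectSum.IsInternal Vg)
    (η β : Module.End ℝ V)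
    (hcomm : Commute η β)
    (hη : ∀ i j : ℤ, (Vg (i, j)).map η ≤ Vg (i + 2, j + 2))
    (hβ : ∀ i j : ℤ, (Vg (i, j)).map β ≤ Vg (i, j + 2))
    (hRHL : ∀ (i : ℕ) (j : ℤ),
      (Vg (-(i : ℤ), j)).map (η ^ i) = Vg ((i : ℤ), j + 2 * i) ∧
      ∀ v ∈ Vg (-(i : ℤ), j), (η ^ i) v = 0 → v = 0)
    (hHLP : ∀ (i : ℤ) (j : ℕ),
      (Vg (i, i - j)).map (β ^ j) = Vg (i, i + j) ∧
      ∀ v ∈ Vg (i, i - j), (β ^ j) v = 0 → v = 0) :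
    ∃ f₁ h₁ f₂ h₂ : Module.End ℝ V,
      (∀ (i j : ℤ), ∀ v ∈ Vg (i, j),
        h₁ v = (i : ℝ) • v ∧ h₂ v = ((j - i : ℤ) : ℝ) • v) ∧
      h₁ * η - η * h₁ = 2 • η ∧
      h₁ * f₁ - f₁ * h₁ = -(2 • f₁) ∧
      η * f₁ - f₁ * η = h₁ ∧
      h₂ * β - β * h₂ = 2 • β ∧
      h₂ * f₂ - f₂ * h₂ = -(2 • f₂) ∧
      β * f₂ - f₂ * β = h₂ ∧
      Commute η β ∧ Commute η f₂ ∧ Commute η h₂ ∧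
      Commute f₁ β ∧ Commute f₁ f₂ ∧ Commute f₁ h₂ ∧
      Commute h₁ β ∧ Commute h₁ f₂ ∧ Commute h₁ h₂ := by
  obtain ⟨h₁, hh₁⟩ := hgrading.exists_linearMap fun p ↦ (p.1 : ℝ) • 1
  obtain ⟨h₂, hh₂⟩ := hgrading.exists_linearMap fun p ↦ ((p.2 - p.1 : ℤ) : ℝ) • 1
  have hh₁' : ∀ p, ∀ v ∈ Vg p, h₁ v = ((AddMonoidHom.fst ℤ ℤ p : ℤ) : ℝ) • v := hh₁
  have hh₂' : ∀ p, ∀ v ∈ Vg p, h₂ v =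
      (((AddMonoidHom.snd ℤ ℤ - AddMonoidHom.fst ℤ ℤ) p : ℤ) : ℝ) • v := hh₂
  have hη' : ∀ p, ∀ v ∈ Vg p, η v ∈ Vg (p + (2, 2)) := fun p v hv ↦
    hη p.1 p.2 (Submodule.mem_map_of_mem hv)
  have hβ' : ∀ p, ∀ v ∈ Vg p, β v ∈ Vg (p + (0, 2)) := by
    rintro ⟨i, j⟩ v hv
    have := hβ i j (Submodule.mem_map_of_mem hv)
    rwa [Prod.mk_add_mk, add_zero]
  obtain ⟨f₁, hη1, hη2, hη3⟩ := exists_sl2_lowering_of_lefschetz hgrading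
    (w := AddMonoidHom.fst ℤ ℤ) (d := (2, 2)) rfl hη' (by
      rintro ⟨i, j⟩ n hn
      obtain rfl : i = -n := hn
      have h : ((-n, j) : ℤ × ℤ) + n • ((2, 2) : ℤ × ℤ) = ((n : ℤ), j + 2 * n) := by
        simp only [Prod.smul_mk, Prod.mk_add_mk, nsmul_eq_mul, Prod.mk.injEq]
        constructor <;> ring
      rw [h]
      exact hRHL n j) hh₁'
  obtain ⟨f₂, hβ1, hβ2, hβ3⟩ := exists_sl2_lowering_of_lefschetz hgrading
    (w := AddMonoidHom.snd ℤ ℤ - AddMonoidHom.fst ℤ ℤ) (d := (0, 2)) rfl hβ' (by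
      rintro ⟨i, j⟩ n hn
      replace hn : j - i = -n := hn
      obtain rfl : j = i - n := by omega
      have h : ((i, i - n) : ℤ × ℤ) + n • ((0, 2) : ℤ × ℤ) = (i, i + (n : ℤ)) := by
        simp only [Prod.smul_mk, Prod.mk_add_mk, nsmul_eq_mul, Prod.mk.injEq]
        constructor <;> ring
      rw [h]
      exact hHLP i n) hh₂'
  have hηh₂ : Commute η h₂ := hgrading.linearMap_ext fun p v hv ↦ by
    rw [Module.End.mul_apply, Module.End.mul_apply, hh₂ p v hv, hh₂ _ _ (hη' p v hv)]
    simp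
  have hh₁β : Commute h₁ β := hgrading.linearMap_ext fun p v hv ↦ by
    rw [Module.End.mul_apply, Module.End.mul_apply, hh₁ p v hv, hh₁ _ _ (hβ' p v hv)]
    simp
  have hh₁h₂ : Commute h₁ h₂ := hgrading.linearMap_ext fun p v hv ↦ by
    rw [Module.End.mul_apply, Module.End.mul_apply, hh₂ p v hv, hh₁ p v hv]
    simp only [LinearMap.smul_apply, Module.End.one_apply, map_smul]
    rw [hh₂ p v hv, hh₁ p v hv]
    exact smul_comm _ _ _
  have hf₁β : Commute f₁ β :=
    (commute_sl2_lowering hη1 hη2 hη3 hcomm.symm hh₁β.symm).symm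
  have hf₁h₂ : Commute f₁ h₂ :=
    (commute_sl2_lowering hη1 hη2 hη3 hηh₂.symm hh₁h₂.symm).symm
  exact ⟨f₁, h₁, f₂, h₂, fun i j v hv ↦ ⟨hh₁ _ v hv, hh₂ _ v hv⟩, hη1, hη2, hη3, hβ1, hβ2, hβ3,
    hcomm, commute_sl2_lowering hβ1 hβ2 hβ3 hcomm hηh₂, hηh₂,
    hf₁β, commute_sl2_lowering hβ1 hβ2 hβ3 hf₁β hf₁h₂, hf₁h₂,
    hh₁β, commute_sl2_lowering hβ1 hβ2 hβ3 hh₁β hh₁h₂, hh₁h₂⟩
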